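/- For any integer d ≥ 1, any positive integers N_1, …, N_d, and any permutations σ, τ of {1,…,d}, if T_σ denotes the vector transformation defined with respect to the sizes (N_1,…,N_d) and T_τ denotes the vector transformation defined with respect to the permuted sizes (N_{σ(1)},…,N_{σ(d)}), then T_τ ∘ T_σ = T_{σ∘τ}, where T_{σ∘τ} is defined with respect to (N_1,…,N_d). -/

import Mathlib

/-- The linear index map `I_{N_1,…,N_d}` sending a multi-index `(i_1,…,i_d)`
(with `0 ≤ i_k ≤ N_k`) to `∑_{l=2}^d ( i_l ∏_{j=1}^{l-1} (N_j+1) ) + i_1 + 1`,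
written here (0-indexed) as `∑_l i_l ∏_{j<l} (N_j+1) + 1`. -/
def indexMap {d : ℕ} (N : Fin d → ℕ) (i : ∀ k, Fin (N k + 1)) : ℕ :=
  (∑ l : Fin d, (i l : ℕ) * ∏ j ∈ Finset.univ.filter (fun j => j < l), (N j + 1)) + 1

theorem index_surj_aux : ∀ {d : ℕ} (M : Fin d → ℕ) (m : ℕ), m < ∏ k, (M k + 1) →
    ∃ i : ∀ k, Fin (M k + 1),
      (∑ l : Fin d, (i l : ℕ) * ∏ j ∈ Finset.univ.filter (fun j => j < l), (M j + 1)) = m := by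
  intro d
  induction d with
  | zero =>
    intro M m hm
    refine ⟨fun k => 0, ?_⟩
    simp at hm ⊢
    omega
  | succ d ih =>
    intro M m hm
    rw [Fin.prod_univ_succ] at hm
    obtain ⟨i, hi⟩ := ih (fun k => M k.succ) (m / (M 0 + 1)) (Nat.div_lt_of_lt_mul hm)
    refine ⟨Fin.cons ⟨m % (M 0 + 1), Nat.mod_lt _ (Nat.succ_pos _)⟩ i, ?_⟩
    rw [Fin.sum_univ_succ]
    have h2 : ∀ l : Fin d, (∏ j ∈ Finset.univ.filter (fun j => j < l.succ), (M j + 1))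
        = (M 0 + 1) * ∏ j ∈ Finset.univ.filter (fun j => j < l), (M j.succ + 1) := by
      intro l
      rw [Finset.prod_filter, Fin.prod_univ_succ, Finset.prod_filter]
      simp
    simp only [h2, Fin.cons_zero, Fin.cons_succ]
    have h3 : (Finset.univ.filter (fun j : Fin (d+1) => j < 0)) = ∅ := by
      ext j; simp
    rw [h3, Finset.prod_empty, mul_one]
    have h4 := Nat.mod_add_div m (M 0 + 1)
    rw [← hi, Finset.mul_sum] at h4
    refine Eq.trans ?_ h4
    congr 1
    exact Finset.sum_congr rfl (fun x _ => mul_left_comm _ _ _)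

/-- For `d ≥ 1`, positive integers `N_1,…,N_d` and permutations `σ, τ`:
if `T` is the vector transformation `T_σ` defined w.r.t. the sizes `(N_1,…,N_d)`
and `S` is the vector transformation `T_τ` defined w.r.t. the permuted sizes
`(N_{σ(1)},…,N_{σ(d)})`, then `T_τ ∘ T_σ = T_{σ∘τ}` where `T_{σ∘τ}` is defined
w.r.t. `(N_1,…,N_d)`: the composite `S ∘ T` satisfies the defining property of
`T_{σ∘τ}`, and it agrees on the index set `{1,…,N_dof}` with any map satisfying
that defining property. -/
theorem vecTrans_comp {d : ℕ} (hd : 1 ≤ d) (N : Fin d → ℕ) (hN : ∀ k, 0 < N k)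
    (σ τ : Equiv.Perm (Fin d)) (T S : (ℕ → ℂ) → (ℕ → ℂ))
    (hT : ∀ (U : ℕ → ℂ) (i : ∀ k, Fin (N k + 1)),
      T U (indexMap (fun k => N (σ k)) (fun k => i (σ k))) = U (indexMap N i))
    (hS : ∀ (V : ℕ → ℂ) (j : ∀ k, Fin (N (σ k) + 1)),
      S V (indexMap (fun k => N (σ (τ k))) (fun k => j (τ k)))
        = V (indexMap (fun k => N (σ k)) j)) :
    (∀ (U : ℕ → ℂ) (i : ∀ k, Fin (N k + 1)),
      (S ∘ T) U (indexMap (fun k => N (σ (τ k))) (fun k => i (σ (τ k)))) = U (indexMap N i)) ∧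
    (∀ R : (ℕ → ℂ) → (ℕ → ℂ),
      (∀ (U : ℕ → ℂ) (i : ∀ k, Fin (N k + 1)),
        R U (indexMap (fun k => N (σ (τ k))) (fun k => i (σ (τ k)))) = U (indexMap N i)) →
      ∀ (U : ℕ → ℂ), ∀ m ∈ Set.Icc 1 (∏ k, (N k + 1)), R U m = (S ∘ T) U m) := by
  have h1 : ∀ (U : ℕ → ℂ) (i : ∀ k, Fin (N k + 1)),
      (S ∘ T) U (indexMap (fun k => N (σ (τ k))) (fun k => i (σ (τ k)))) = U (indexMap N i) := by
    intro U i
    exact (hS (T U) (fun k => i (σ k))).trans (hT U i)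
  refine ⟨h1, ?_⟩
  intro R hR U m hm
  have hp : ∏ k, (N (σ (τ k)) + 1) = ∏ k, (N k + 1) :=
    Equiv.prod_comp (τ.trans σ) (fun k => N k + 1)
  obtain ⟨j, hj⟩ := index_surj_aux (fun k => N (σ (τ k))) (m - 1) (by
    rw [hp]; have := hm.1; have := hm.2; omega)
  have hm' : m = indexMap (fun k => N (σ (τ k))) j := by
    unfold indexMap
    rw [hj]; have := hm.1; omega
  obtain ⟨i, hi⟩ : ∃ i : ∀ k, Fin (N k + 1), (fun k => i (σ (τ k))) = j :=
    ⟨Equiv.piCongrLeft (fun k => Fin (N k + 1)) (τ.trans σ) j, by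
      funext k
      exact Equiv.piCongrLeft_apply_apply (fun k => Fin (N k + 1)) (τ.trans σ) j k⟩
  rw [hm', ← hi, hR, h1]
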